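/- Let G be a TLG on {1,…,N} (N ≥ 3) in which vertex 1 is adjacent exactly to vertices 2 and 3 and (2,3) ∈ E, let (f_ij) ∈ 𝓕^{|E|}, and let p be an equilibrium line configuration on the a-axis with distances d_12, d_13. Let F_{p*} be the matrix formed for the reduced system associated with p at p* = (x_2,…,x_N). Then 𝐧(F_p) − 𝐧(F_{p*}) = sgn(−f_12(d_12) − f_13(d_13)). -/

import Mathlib

open Set Filter Topology MeasureTheory Matrix Function

attribute [local instance] Classical.propDecidable

noncomputable section

/-- `f̃(d) = d * f(d)`. -/
def tildeFn (f : ℝ → ℝ) : ℝ → ℝ := fun d => d * f d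

/-- Membership in the class `𝓕` of monotone interaction laws:
`f` is `C¹` on `ℝ₊ = (0,∞)`, `f̃′ > 0` on `ℝ₊`, `f̃` has a zero, and
`∫_d^1 f̃(x) dx → −∞` as `d → 0⁺`. -/
def MemF (f : ℝ → ℝ) : Prop :=
  ContDiffOn ℝ 1 f (Set.Ioi 0) ∧
  (∀ d > (0:ℝ), 0 < deriv (tildeFn f) d) ∧
  (∃ d > (0:ℝ), tildeFn f d = 0) ∧
  Tendsto (fun d => ∫ x in d..(1:ℝ), tildeFn f x) (𝓝[>] (0:ℝ)) atBot

/-- The space `C¹(ℝ₊, ℝ)`. -/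
def C1Pos : Type := {f : ℝ → ℝ // ContDiffOn ℝ 1 f (Set.Ioi 0)}

/-- The Whitney `C¹`-topology on `C¹(ℝ₊, ℝ)`, generated by the basic open sets
`B_δ(f) = {g : |g(d) − f(d)| + |g′(d) − f′(d)| < δ(d) for all d > 0}`. -/
instance : TopologicalSpace C1Pos :=
  TopologicalSpace.generateFrom
    { S | ∃ (f : C1Pos) (δ : ℝ → ℝ), ContinuousOn δ (Set.Ioi 0) ∧ (∀ d > (0:ℝ), 0 < δ d) ∧
        S = { g : C1Pos | ∀ d > (0:ℝ), |g.1 d - f.1 d| + |deriv g.1 d - deriv f.1 d| < δ d } }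

/-- The class `𝓕` as a topological space (subspace of `C¹(ℝ₊,ℝ)`). -/
def FF : Type := {f : C1Pos // MemF f.1}

instance : TopologicalSpace FF := instTopologicalSpaceSubtype

/-- `G` is a triangulated Laman graph: there is a Henneberg-type construction order
(a relabeling `σ`) starting from the edge between the first two vertices, in which every
later vertex is joined to exactly two earlier, adjacent, vertices. -/
def IsTLG {N : ℕ} (G : SimpleGraph (Fin N)) : Prop :=
  2 ≤ N ∧
  ∃ (σ : Equiv.Perm (Fin N)) (par₁ par₂ : Fin N → Fin N),
    (∀ k : Fin N, 2 ≤ (k : ℕ) →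
      ((par₁ k : ℕ) < (k : ℕ) ∧ (par₂ k : ℕ) < (k : ℕ) ∧ par₁ k ≠ par₂ k ∧
        G.Adj (σ (par₁ k)) (σ (par₂ k)))) ∧
    (∀ i j : Fin N, G.Adj (σ i) (σ j) ↔
      (((i : ℕ) = 0 ∧ (j : ℕ) = 1) ∨ ((i : ℕ) = 1 ∧ (j : ℕ) = 0) ∨
       (2 ≤ (i : ℕ) ∧ (j = par₁ i ∨ j = par₂ i)) ∨
       (2 ≤ (j : ℕ) ∧ (i = par₁ j ∨ i = par₂ j))))

/-- Euclidean distance on `ℝ²` (coordinates `(a,b)`). -/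
def dist2 (x y : ℝ × ℝ) : ℝ := Real.sqrt ((x.1 - y.1)^2 + (x.2 - y.2)^2)

/-- `p` belongs to the configuration space `P`: no collision of adjacent agents. -/
def InConfigSpace {N : ℕ} (G : SimpleGraph (Fin N)) (p : Fin N → ℝ × ℝ) : Prop :=
  ∀ i j, G.Adj i j → p i ≠ p j

/-- `p` is an equilibrium of the RMA system `ẋᵢ = Σ_{j : (i,j) ∈ E} f_ij(d_ij)(x_j − x_i)`. -/
def IsEquilibrium {N : ℕ} (G : SimpleGraph (Fin N)) (f : Fin N → Fin N → ℝ → ℝ)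
    (p : Fin N → ℝ × ℝ) : Prop :=
  ∀ i, (∑ j, if G.Adj i j then (f i j (dist2 (p i) (p j))) • (p j - p i) else (0:ℝ×ℝ)) = 0

/-- The potential function `Φ(p) = Σ_{(i,j) ∈ E} ∫_1^{d_ij} x f_ij(x) dx`
(each edge counted once; the factor 1/2 compensates the double count over ordered pairs). -/
def potential {N : ℕ} (G : SimpleGraph (Fin N)) (f : Fin N → Fin N → ℝ → ℝ)
    (p : Fin N → ℝ × ℝ) : ℝ :=
  (1/2) * ∑ i, ∑ j, if G.Adj i j then ∫ x in (1:ℝ)..(dist2 (p i) (p j)), x * f i j x else 0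

/-- Coordinate directions on the configuration space, in the order `(a₁,…,a_N,b₁,…,b_N)`. -/
def basisVec {N : ℕ} : (Fin N ⊕ Fin N) → (Fin N → ℝ × ℝ) :=
  Sum.elim (fun i => Pi.single i ((1:ℝ), (0:ℝ))) (fun i => Pi.single i ((0:ℝ), (1:ℝ)))

/-- The Hessian matrix of `Φ` at `p` in the coordinates `(a₁,…,a_N,b₁,…,b_N)`. -/
def hessian {N : ℕ} (Φ : (Fin N → ℝ × ℝ) → ℝ) (p : Fin N → ℝ × ℝ) :
    Matrix (Fin N ⊕ Fin N) (Fin N ⊕ Fin N) ℝ :=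
  Matrix.of fun u v => fderiv ℝ (fun q => fderiv ℝ Φ q (basisVec v)) p (basisVec u)

/-- The inertia `𝐧(M) = (n₊(M), n₀(M), n₋(M))` of a real symmetric matrix: the numbers of
positive, zero, and negative eigenvalues (counted with multiplicity). -/
def inertia {m : Type*} [Fintype m] [DecidableEq m] (M : Matrix m m ℝ) : ℕ × ℕ × ℕ :=
  if h : M.IsHermitian then
    ((Finset.univ.filter fun i => 0 < h.eigenvalues i).card,
     (Finset.univ.filter fun i => h.eigenvalues i = 0).card,
     (Finset.univ.filter fun i => h.eigenvalues i < 0).card)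
  else (0, 0, 0)

/-- The number `n₀(M)` of zero eigenvalues of a real symmetric matrix. -/
def n0 {m : Type*} [Fintype m] [DecidableEq m] (M : Matrix m m ℝ) : ℕ := (inertia M).2.1

/-- The vector-valued sign function. -/
def sgn3 (x : ℝ) : ℕ × ℕ × ℕ :=
  if 0 < x then (1,0,0) else if x = 0 then (0,1,0) else (0,0,1)

/-- `q` lies in the `SE(2)`-orbit of `p` (rigid motions: rotation by `(c,s)` with
`c² + s² = 1` followed by translation by `(vx,vy)`). -/
def sameOrbit {N : ℕ} (p q : Fin N → ℝ × ℝ) : Prop :=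
  ∃ c s vx vy : ℝ, c^2 + s^2 = 1 ∧
    ∀ i, q i = (c * (p i).1 - s * (p i).2 + vx, s * (p i).1 + c * (p i).2 + vy)

/-- The interaction laws determined by an ensemble `ω ∈ 𝓕^{|E|}`. -/
def ensembleLaws {N : ℕ} {G : SimpleGraph (Fin N)} (ω : G.edgeSet → FF) :
    Fin N → Fin N → ℝ → ℝ :=
  fun i j => if h : G.Adj i j then (ω ⟨s(i,j), G.mem_edgeSet.mpr h⟩).1.1 else 0

/-- The line configuration on the `a`-axis with coordinates `a`. -/
def lineConfig {N : ℕ} (a : Fin N → ℝ) : Fin N → ℝ × ℝ := fun i => (a i, 0)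

/-- The matrix `F_p` of a line configuration with coordinates `a`: symmetric, zero row sums,
off-diagonal entries `φ_ij(d_ij)` on edges and `0` otherwise. -/
def FMat {N : ℕ} (G : SimpleGraph (Fin N)) (φ : Fin N → Fin N → ℝ → ℝ)
    (a : Fin N → ℝ) : Matrix (Fin N) (Fin N) ℝ :=
  Matrix.of fun i j =>
    if i = j then -∑ k, (if G.Adj i k then φ i k |a i - a k| else 0)
    else if G.Adj i j then φ i j |a i - a j| else 0

/-- The matrix `d̃F_p`: off-diagonal entries `f̃′_ij(d_ij)` on edges. -/
def dFMat {N : ℕ} (G : SimpleGraph (Fin N)) (f : Fin N → Fin N → ℝ → ℝ)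
    (a : Fin N → ℝ) : Matrix (Fin N) (Fin N) ℝ :=
  FMat G (fun i j d => deriv (tildeFn (f i j)) d) a

/-- Case 1 balanced distance: the (generically unique) `d₁₂(d)` with `0 < d₁₂ < d` and
`f̃₁₂(d₁₂) = f̃₁₃(d − d₁₂)`. -/
def case1d12 (f12 f13 : ℝ → ℝ) (d : ℝ) : ℝ :=
  Classical.epsilon fun t => 0 < t ∧ t < d ∧ tildeFn f12 t = tildeFn f13 (d - t)

/-- The case-1 virtual interaction: `g̃₂₃(d) = f̃₁₂(d₁₂(d))`. -/
def g23Case1 (f12 f13 : ℝ → ℝ) : ℝ → ℝ :=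
  fun d => tildeFn f12 (case1d12 f12 f13 d) / d

/-- Case 2 balanced distance: the (generically unique) `d₁₂(d) > 0` with
`f̃₁₂(d₁₂) + f̃₁₃(d₁₂ + d) = 0`. -/
def case2d12 (f12 f13 : ℝ → ℝ) (d : ℝ) : ℝ :=
  Classical.epsilon fun t => 0 < t ∧ tildeFn f12 t + tildeFn f13 (t + d) = 0

/-- The case-2 virtual interaction: `g̃₂₃(d) = f̃₁₃(d₁₃(d))`, `d₁₃(d) = d₁₂(d) + d`. -/
def g23Case2 (f12 f13 : ℝ → ℝ) : ℝ → ℝ :=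
  fun d => tildeFn f13 (case2d12 f12 f13 d + d) / d

/-- The case-3 virtual interaction: case 2 with the roles of agents 2,3 (and `f₁₂`,`f₁₃`)
interchanged. -/
def g23Case3 (f12 f13 : ℝ → ℝ) : ℝ → ℝ := g23Case2 f13 f12

/-- The virtual interaction between agents 2 and 3 induced by `f₁₂`, `f₁₃`, chosen according
to which of the three aligned agents (at coordinates `a1`, `a2`, `a3`) lies between the
other two. -/
def virtualG (f12 f13 : ℝ → ℝ) (a1 a2 a3 : ℝ) : ℝ → ℝ :=
  if (a2 < a1 ∧ a1 < a3) ∨ (a3 < a1 ∧ a1 < a2) then g23Case1 f12 f13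
  else if (a1 < a2 ∧ a2 < a3) ∨ (a3 < a2 ∧ a2 < a1) then g23Case2 f12 f13
  else g23Case3 f12 f13

/-- The interaction laws of the reduced system: vertex `0` (the last Henneberg vertex,
the paper's vertex 1) is deleted, reduced vertex `i` is original vertex `i+1`, and the law on
the reduced edge `(0,1)` (the paper's edge `(2,3)`) is `f*₂₃ = f₂₃ + g₂₃`. -/
def reducedLaws {n : ℕ} (f : Fin (n+3) → Fin (n+3) → ℝ → ℝ) (g : ℝ → ℝ) :
    Fin (n+2) → Fin (n+2) → ℝ → ℝ :=
  fun i j => if (i = 0 ∧ j = 1) ∨ (i = 1 ∧ j = 0)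
    then fun d => f i.succ j.succ d + g d
    else f i.succ j.succ

end

theorem card_filter_sign {ι : Type*} [Fintype ι] (w : ι → ℝ) :
    (Finset.univ.filter fun i => 0 < w i).card + (Finset.univ.filter fun i => w i = 0).card
      + (Finset.univ.filter fun i => w i < 0).card = Fintype.card ι := by
  simp only [Finset.card_filter, ← Finset.sum_add_distrib]
  rw [← Finset.card_univ, Finset.card_eq_sum_ones]
  refine Finset.sum_congr rfl fun i _ => ?_
  rcases lt_trichotomy (w i) 0 with h | h | h
  · simp [h, h.ne, h.not_gt]
  · simp [h]
  · simp [h, h.ne', h.not_gt]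

theorem exists_diagonalization {m : Type*} [Fintype m] [DecidableEq m]
    {M : Matrix m m ℝ} (hM : M.IsHermitian) :
    ∃ e : (m → ℝ) ≃ₗ[ℝ] (m → ℝ), ∀ x, x ⬝ᵥ M *ᵥ x = ∑ i, hM.eigenvalues i * e x i ^ 2 := by
  set U : Matrix m m ℝ := (hM.eigenvectorUnitary : Matrix m m ℝ)
  have h1 : star U * U = 1 := Unitary.coe_star_mul_self _
  have h2 : U * star U = 1 := Unitary.coe_mul_star_self _
  refine ⟨Matrix.toLin'OfInv h2 h1, fun x => ?_⟩
  have hs : M = U * diagonal hM.eigenvalues * star U := by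
    conv_lhs => rw [hM.spectral_theorem]
    rw [Unitary.conjStarAlgAut_apply]
    rfl
  have ht : star U = Uᵀ := by
    rw [Matrix.star_eq_conjTranspose, Matrix.conjTranspose_eq_transpose_of_trivial]
  have hx : x ⬝ᵥ M *ᵥ x = (star U *ᵥ x) ⬝ᵥ diagonal hM.eigenvalues *ᵥ (star U *ᵥ x) := by
    conv_lhs => rw [hs]
    rw [← mulVec_mulVec, ← mulVec_mulVec, dotProduct_mulVec, ht, mulVec_transpose]
  rw [hx]
  simp only [dotProduct, mulVec_diagonal, Matrix.toLin'OfInv_apply, Matrix.toLin'_apply]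
  exact Finset.sum_congr rfl fun i _ => by ring

/-- **Sylvester's law of inertia**: the inertia of a symmetric matrix is given by the signs of the
weights in any diagonalization of its quadratic form. -/
theorem inertia_eq_of_diagonalization {m ι : Type*} [Fintype m] [DecidableEq m] [Fintype ι]
    {M : Matrix m m ℝ} (hM : M.IsHermitian) (e : (m → ℝ) ≃ₗ[ℝ] (ι → ℝ)) (w : ι → ℝ)
    (he : ∀ x, x ⬝ᵥ M *ᵥ x = ∑ i, w i * e x i ^ 2) :
    inertia M = ((Finset.univ.filter fun i => 0 < w i).card,
      (Finset.univ.filter fun i => w i = 0).card,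
      (Finset.univ.filter fun i => w i < 0).card) := by
  obtain ⟨e', he'⟩ := exists_diagonalization hM
  have h : QuadraticMap.Equivalent (QuadraticMap.weightedSumSquares ℝ hM.eigenvalues)
      (QuadraticMap.weightedSumSquares ℝ w) := by
    refine ⟨⟨e'.symm.trans e, fun y => ?_⟩⟩
    have h1 := he (e'.symm y)
    rw [he', e'.apply_symm_apply] at h1
    simpa [QuadraticMap.weightedSumSquares_apply, pow_two] using h1.symm
  have hp := h.sigPos_eq
  have hn := h.sigNeg_eq
  rw [QuadraticForm.sigPos_weightedSumSquares, QuadraticForm.sigPos_weightedSumSquares] at hp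
  rw [QuadraticForm.sigNeg_weightedSumSquares, QuadraticForm.sigNeg_weightedSumSquares] at hn
  have hc : Fintype.card m = Fintype.card ι := by simpa using e.finrank_eq
  have hv := card_filter_sign hM.eigenvalues
  have hw := card_filter_sign w
  simp only [Set.ncard_eq_toFinset_card', Set.toFinset_ofPred] at hp hn
  unfold inertia
  rw [dif_pos hM, Prod.mk.injEq, Prod.mk.injEq]
  refine ⟨?_, ?_, ?_⟩
  · convert hp
  · omega
  · convert hn

/-- Inertia additivity when one square is split off from the quadratic form. -/
theorem inertia_of_split_square {k : ℕ} {M : Matrix (Fin (k+1)) (Fin (k+1)) ℝ}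
    {M' : Matrix (Fin k) (Fin k) ℝ} (hM : M.IsHermitian) (hM' : M'.IsHermitian) (c : ℝ)
    (l : (Fin k → ℝ) →ₗ[ℝ] ℝ)
    (h : ∀ (t : ℝ) (y : Fin k → ℝ),
      (Fin.cons t y : Fin (k+1) → ℝ) ⬝ᵥ M *ᵥ (Fin.cons t y : Fin (k+1) → ℝ)
        = c * (t - l y) ^ 2 + y ⬝ᵥ M' *ᵥ y) :
    inertia M = inertia M' + sgn3 c := by
  obtain ⟨e', he'⟩ := exists_diagonalization hM'
  let E : (Fin (k+1) → ℝ) ≃ₗ[ℝ] (Fin (k+1) → ℝ) :=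
    { toFun := fun x => Fin.cons (x 0 - l (Fin.tail x)) (e' (Fin.tail x))
      map_add' := fun x y => by
        have : Fin.tail (x + y) = Fin.tail x + Fin.tail y := rfl
        funext i
        refine Fin.cases ?_ (fun j => ?_) i
        · simp [this]; ring
        · simp [this]
      map_smul' := fun r x => by
        have : Fin.tail (r • x) = r • Fin.tail x := rfl
        funext i
        refine Fin.cases ?_ (fun j => ?_) i
        · simp [this]; ring
        · simp [this]
      invFun := fun z => Fin.cons (z 0 + l (e'.symm (Fin.tail z))) (e'.symm (Fin.tail z))
      left_inv := fun x => by
        conv_rhs => rw [← Fin.cons_self_tail x]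
        simp
      right_inv := fun z => by
        conv_rhs => rw [← Fin.cons_self_tail z]
        simp }
  have hE : ∀ x, x ⬝ᵥ M *ᵥ x =
      ∑ i, (Fin.cons c hM'.eigenvalues : Fin (k+1) → ℝ) i * E x i ^ 2 := by
    intro x
    have := h (x 0) (Fin.tail x)
    rw [Fin.cons_self_tail, he'] at this
    rw [this, Fin.sum_univ_succ]
    rfl
  rw [inertia_eq_of_diagonalization hM E _ hE]
  unfold inertia
  rw [dif_pos hM']
  simp only [Finset.card_filter, Fin.sum_univ_succ, Fin.cons_zero, Fin.cons_succ]
  rcases lt_trichotomy c 0 with hc | hc | hc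
  · simp [sgn3, hc, hc.ne, hc.not_gt, add_comm]
  · simp [sgn3, hc, add_comm]
  · simp [sgn3, hc, hc.ne', hc.not_gt, add_comm]

theorem FMat_isHermitian {N : ℕ} (G : SimpleGraph (Fin N)) (φ : Fin N → Fin N → ℝ → ℝ)
    (hφ : ∀ i j, φ i j = φ j i) (a : Fin N → ℝ) : (FMat G φ a).IsHermitian := by
  ext i j
  simp only [FMat, conjTranspose_apply, of_apply, star_trivial]
  by_cases hij : i = j
  · subst hij; rfl
  · rw [if_neg hij, if_neg (Ne.symm hij), hφ i j, abs_sub_comm, G.adj_comm]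

theorem FMat_dotProduct {N : ℕ} (G : SimpleGraph (Fin N)) (φ : Fin N → Fin N → ℝ → ℝ)
    (a x : Fin N → ℝ) :
    x ⬝ᵥ FMat G φ a *ᵥ x
      = ∑ i, x i * ∑ j, (if G.Adj i j then φ i j |a i - a j| else 0) * (x j - x i) := by
  simp only [dotProduct, mulVec]
  refine Finset.sum_congr rfl fun i _ => ?_
  congr 1
  have h : ∀ j, FMat G φ a i j = (if G.Adj i j then φ i j |a i - a j| else 0)
      + if i = j then -∑ k, (if G.Adj i k then φ i k |a i - a k| else 0) else 0 := by
    intro j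
    by_cases hij : i = j
    · subst hij; simp [FMat]
    · simp [FMat, hij]
  simp only [h, add_mul, mul_sub, Finset.sum_add_distrib, Finset.sum_sub_distrib, ite_mul, zero_mul,
    Finset.sum_ite_eq, Finset.mem_univ, if_true, neg_mul, ← sub_eq_add_neg]
  congr 1
  rw [Finset.sum_mul]
  simp only [ite_mul, zero_mul]

theorem MemF.strictMonoOn {f : ℝ → ℝ} (hf : MemF f) : StrictMonoOn (tildeFn f) (Set.Ioi 0) := by
  refine strictMonoOn_of_deriv_pos (convex_Ioi 0) (fun d hd => ?_) (fun d hd => ?_)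
  · exact (differentiableAt_of_deriv_ne_zero (hf.2.1 d hd).ne').continuousAt.continuousWithinAt
  · rw [interior_Ioi] at hd
    exact hf.2.1 d hd

theorem case1d12_eq {f₁ f₂ : ℝ → ℝ} (h₁ : MemF f₁) (h₂ : MemF f₂) {s d : ℝ} (hs : 0 < s)
    (hsd : s < d) (h : tildeFn f₁ s = tildeFn f₂ (d - s)) : case1d12 f₁ f₂ d = s := by
  obtain ⟨ht, htd, e⟩ := Classical.epsilon_spec
    (p := fun t => 0 < t ∧ t < d ∧ tildeFn f₁ t = tildeFn f₂ (d - t)) ⟨s, hs, hsd, h⟩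
  change 0 < case1d12 f₁ f₂ d at ht
  change case1d12 f₁ f₂ d < d at htd
  change tildeFn f₁ (case1d12 f₁ f₂ d) = tildeFn f₂ (d - case1d12 f₁ f₂ d) at e
  rcases lt_trichotomy (case1d12 f₁ f₂ d) s with hlt | heq | hlt
  · have a₁ := h₁.strictMonoOn ht hs hlt
    have a₂ := h₂.strictMonoOn (show d - s ∈ Set.Ioi 0 from sub_pos.2 hsd)
      (show d - case1d12 f₁ f₂ d ∈ Set.Ioi 0 from sub_pos.2 htd) (by linarith)
    linarith
  · exact heq
  · have a₁ := h₁.strictMonoOn hs ht hlt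
    have a₂ := h₂.strictMonoOn (show d - case1d12 f₁ f₂ d ∈ Set.Ioi 0 from sub_pos.2 htd)
      (show d - s ∈ Set.Ioi 0 from sub_pos.2 hsd) (by linarith)
    linarith

theorem case2d12_eq {f₁ f₂ : ℝ → ℝ} (h₁ : MemF f₁) (h₂ : MemF f₂) {s d : ℝ} (hs : 0 < s)
    (hd : 0 < d) (h : tildeFn f₁ s + tildeFn f₂ (s + d) = 0) : case2d12 f₁ f₂ d = s := by
  obtain ⟨ht, e⟩ := Classical.epsilon_spec
    (p := fun t => 0 < t ∧ tildeFn f₁ t + tildeFn f₂ (t + d) = 0) ⟨s, hs, h⟩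
  have hmono : StrictMonoOn (fun t => tildeFn f₁ t + tildeFn f₂ (t + d)) (Set.Ioi 0) :=
    fun x hx y hy hxy => add_lt_add (h₁.strictMonoOn hx hy hxy)
      (h₂.strictMonoOn (show x + d ∈ Set.Ioi 0 from add_pos hx hd)
        (show y + d ∈ Set.Ioi 0 from add_pos hy hd) (by linarith))
  exact hmono.injOn ht hs (e.trans h.symm)

/-- At a balanced position of agent 1, the virtual interaction `g₂₃` is the series combination
`f₁₂ f₁₃ / (f₁₂ + f₁₃)`, stated without division. -/
theorem virtualG_mul {f₁ f₂ : ℝ → ℝ} (h₁ : MemF f₁) (h₂ : MemF f₂) {a₁ a₂ a₃ : ℝ}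
    (h12 : a₁ ≠ a₂) (h13 : a₁ ≠ a₃) (h23 : a₂ ≠ a₃)
    (h : f₁ |a₁ - a₂| * (a₂ - a₁) + f₂ |a₁ - a₃| * (a₃ - a₁) = 0) :
    virtualG f₁ f₂ a₁ a₂ a₃ |a₂ - a₃| * (a₃ - a₂) = f₂ |a₁ - a₃| * (a₃ - a₁) := by
  have p12 := abs_pos.2 (sub_ne_zero.2 h12)
  have p13 := abs_pos.2 (sub_ne_zero.2 h13)
  have p23 := abs_pos.2 (sub_ne_zero.2 h23)
  have n23 : a₂ - a₃ ≠ 0 := sub_ne_zero.2 h23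
  have n32 : a₃ - a₂ ≠ 0 := sub_ne_zero.2 h23.symm
  unfold virtualG
  split_ifs with c1 c2
  · have hd : |a₂ - a₃| - |a₁ - a₂| = |a₁ - a₃| := by
      rcases c1 with ⟨u, v⟩ | ⟨u, v⟩
      · rw [abs_of_neg (by linarith : a₂ - a₃ < 0), abs_of_pos (by linarith : 0 < a₁ - a₂),
          abs_of_neg (by linarith : a₁ - a₃ < 0)]; ring
      · rw [abs_of_pos (by linarith : 0 < a₂ - a₃), abs_of_neg (by linarith : a₁ - a₂ < 0),
          abs_of_pos (by linarith : 0 < a₁ - a₃)]; ring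
    have hk : tildeFn f₁ |a₁ - a₂| = tildeFn f₂ |a₁ - a₃| := by
      unfold tildeFn
      generalize f₁ |a₁ - a₂| = w₁ at *
      generalize f₂ |a₁ - a₃| = w₂ at *
      rcases c1 with ⟨u, v⟩ | ⟨u, v⟩
      · rw [abs_of_pos (by linarith : 0 < a₁ - a₂), abs_of_neg (by linarith : a₁ - a₃ < 0)]
        linarith
      · rw [abs_of_neg (by linarith : a₁ - a₂ < 0), abs_of_pos (by linarith : 0 < a₁ - a₃)]
        linarith
    rw [g23Case1, case1d12_eq h₁ h₂ p12 (by linarith) (by rw [hd, hk]), hk]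
    unfold tildeFn
    generalize f₂ |a₁ - a₃| = w₂
    rcases c1 with ⟨u, v⟩ | ⟨u, v⟩
    · rw [abs_of_neg (by linarith : a₁ - a₃ < 0), abs_of_neg (by linarith : a₂ - a₃ < 0)]
      field_simp; ring
    · rw [abs_of_pos (by linarith : 0 < a₁ - a₃), abs_of_pos (by linarith : 0 < a₂ - a₃)]
      field_simp; ring
  · have hd : |a₁ - a₂| + |a₂ - a₃| = |a₁ - a₃| := by
      rcases c2 with ⟨u, v⟩ | ⟨u, v⟩
      · rw [abs_of_neg (by linarith : a₂ - a₃ < 0), abs_of_neg (by linarith : a₁ - a₂ < 0),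
          abs_of_neg (by linarith : a₁ - a₃ < 0)]; ring
      · rw [abs_of_pos (by linarith : 0 < a₂ - a₃), abs_of_pos (by linarith : 0 < a₁ - a₂),
          abs_of_pos (by linarith : 0 < a₁ - a₃)]; ring
    have hk : tildeFn f₁ |a₁ - a₂| + tildeFn f₂ |a₁ - a₃| = 0 := by
      unfold tildeFn
      generalize f₁ |a₁ - a₂| = w₁ at *
      generalize f₂ |a₁ - a₃| = w₂ at *
      rcases c2 with ⟨u, v⟩ | ⟨u, v⟩
      · rw [abs_of_neg (by linarith : a₁ - a₂ < 0), abs_of_neg (by linarith : a₁ - a₃ < 0)]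
        linarith
      · rw [abs_of_pos (by linarith : 0 < a₁ - a₂), abs_of_pos (by linarith : 0 < a₁ - a₃)]
        linarith
    rw [g23Case2, case2d12_eq h₁ h₂ p12 p23 (by rw [hd, hk]), hd]
    unfold tildeFn
    generalize f₂ |a₁ - a₃| = w₂
    rcases c2 with ⟨u, v⟩ | ⟨u, v⟩
    · rw [abs_of_neg (by linarith : a₁ - a₃ < 0), abs_of_neg (by linarith : a₂ - a₃ < 0)]
      field_simp; ring
    · rw [abs_of_pos (by linarith : 0 < a₁ - a₃), abs_of_pos (by linarith : 0 < a₂ - a₃)]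
      field_simp; ring
  · have c3 : (a₁ < a₃ ∧ a₃ < a₂) ∨ (a₂ < a₃ ∧ a₃ < a₁) := by
      rcases lt_or_gt_of_ne h12 with u | u <;> rcases lt_or_gt_of_ne h13 with v | v <;>
        rcases lt_or_gt_of_ne h23 with w | w <;> simp_all
    have hd : |a₁ - a₃| + |a₂ - a₃| = |a₁ - a₂| := by
      rcases c3 with ⟨u, v⟩ | ⟨u, v⟩
      · rw [abs_of_pos (by linarith : 0 < a₂ - a₃), abs_of_neg (by linarith : a₁ - a₂ < 0),
          abs_of_neg (by linarith : a₁ - a₃ < 0)]; ring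
      · rw [abs_of_neg (by linarith : a₂ - a₃ < 0), abs_of_pos (by linarith : 0 < a₁ - a₂),
          abs_of_pos (by linarith : 0 < a₁ - a₃)]; ring
    have hk : tildeFn f₂ |a₁ - a₃| + tildeFn f₁ |a₁ - a₂| = 0 := by
      unfold tildeFn
      generalize f₁ |a₁ - a₂| = w₁ at *
      generalize f₂ |a₁ - a₃| = w₂ at *
      rcases c3 with ⟨u, v⟩ | ⟨u, v⟩
      · rw [abs_of_neg (by linarith : a₁ - a₂ < 0), abs_of_neg (by linarith : a₁ - a₃ < 0)]
        linarith
      · rw [abs_of_pos (by linarith : 0 < a₁ - a₂), abs_of_pos (by linarith : 0 < a₁ - a₃)]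
        linarith
    rw [g23Case3, g23Case2, case2d12_eq h₂ h₁ p13 p23 (by rw [hd, hk]), hd,
      eq_neg_of_add_eq_zero_right hk]
    unfold tildeFn
    generalize f₂ |a₁ - a₃| = w₂
    rcases c3 with ⟨u, v⟩ | ⟨u, v⟩
    · rw [abs_of_neg (by linarith : a₁ - a₃ < 0), abs_of_pos (by linarith : 0 < a₂ - a₃)]
      field_simp; ring
    · rw [abs_of_pos (by linarith : 0 < a₁ - a₃), abs_of_neg (by linarith : a₂ - a₃ < 0)]
      field_simp; ring

theorem reducedLaws_symm {n : ℕ} {f : Fin (n+3) → Fin (n+3) → ℝ → ℝ}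
    (hsym : ∀ i j, f i j = f j i) (g : ℝ → ℝ) (i j : Fin (n+2)) :
    reducedLaws f g i j = reducedLaws f g j i := by
  unfold reducedLaws
  rw [hsym i.succ j.succ]
  congr 1
  exact propext (by tauto)

/-- Splitting vertex `0` off from the quadratic form of `F_p`. -/
theorem FMat_dotProduct_cons {n : ℕ} {G : SimpleGraph (Fin (n+3))}
    (h0 : G.neighborSet 0 = {1, 2}) (h12 : G.Adj 1 2)
    {f : Fin (n+3) → Fin (n+3) → ℝ → ℝ} (hsym : ∀ i j, f i j = f j i)
    (a : Fin (n+3) → ℝ) (g : ℝ → ℝ) (t : ℝ) (y : Fin (n+2) → ℝ) :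
    (Fin.cons t y : Fin (n+3) → ℝ) ⬝ᵥ FMat G f a *ᵥ (Fin.cons t y : Fin (n+3) → ℝ)
      = y ⬝ᵥ FMat (G.comap Fin.succ) (reducedLaws f g) (a ∘ Fin.succ) *ᵥ y
        - f 0 1 |a 0 - a 1| * (t - y 0) ^ 2 - f 0 2 |a 0 - a 2| * (t - y 1) ^ 2
        + g |a 1 - a 2| * (y 0 - y 1) ^ 2 := by
  have hadj : ∀ j, G.Adj 0 j ↔ j = 1 ∨ j = 2 := fun j => by
    rw [← SimpleGraph.mem_neighborSet, h0]; rfl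
  have hs0 : (Fin.succ 0 : Fin (n+3)) = 1 := rfl
  have hs1 : (Fin.succ 1 : Fin (n+3)) = 2 := rfl
  have hadj' : ∀ j : Fin (n+2), G.Adj 0 j.succ ↔ j = 0 ∨ j = 1 := fun j => by
    rw [hadj, ← hs0, ← hs1, Fin.succ_inj, Fin.succ_inj]
  have hW0 : ∀ (j : Fin (n+2)) [Decidable (G.Adj 0 j.succ)], (if G.Adj 0 j.succ then f 0 j.succ |a 0 - a j.succ| else 0)
      = (if j = 0 then f 0 1 |a 0 - a 1| else 0) + if j = 1 then f 0 2 |a 0 - a 2| else 0 := by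
    intro j _
    simp only [hadj']
    by_cases j0 : j = 0
    · subst j0; simp
    · by_cases j1 : j = 1
      · subst j1; simp
      · simp [j0, j1]
  have hW0' : ∀ (j : Fin (n+2)) [Decidable (G.Adj j.succ 0)], (if G.Adj j.succ 0 then f j.succ 0 |a j.succ - a 0| else 0)
      = (if j = 0 then f 0 1 |a 0 - a 1| else 0) + if j = 1 then f 0 2 |a 0 - a 2| else 0 := by
    intro j _
    rw [← hW0, hsym, abs_sub_comm]
    simp only [G.adj_comm]
  have hW : ∀ (i j : Fin (n+2)) [Decidable ((G.comap Fin.succ).Adj i j)], (if (G.comap Fin.succ).Adj i j then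
        reducedLaws f g i j |(a ∘ Fin.succ) i - (a ∘ Fin.succ) j| else 0)
      = (if G.Adj i.succ j.succ then f i.succ j.succ |a i.succ - a j.succ| else 0)
        + ((if i = 0 then if j = 1 then g |a 1 - a 2| else 0 else 0)
        + if i = 1 then if j = 0 then g |a 1 - a 2| else 0 else 0) := by
    intro i j _
    simp only [SimpleGraph.comap_adj, Function.comp_apply, reducedLaws]
    by_cases c : i = 0 ∧ j = 1
    · obtain ⟨rfl, rfl⟩ := c
      simp [hs0, hs1, h12]
    · by_cases c' : i = 1 ∧ j = 0
      · obtain ⟨rfl, rfl⟩ := c'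
        simp [hs0, hs1, h12.symm, abs_sub_comm]
      · have e1 : (if i = 0 then if j = 1 then g |a 1 - a 2| else 0 else 0) = 0 := by
          rw [← ite_and, if_neg c]
        have e2 : (if i = 1 then if j = 0 then g |a 1 - a 2| else 0 else 0) = 0 := by
          rw [← ite_and, if_neg c']
        rw [if_neg (not_or.2 ⟨c, c'⟩), e1, e2, add_zero, add_zero]
  rw [FMat_dotProduct, FMat_dotProduct]
  simp only [hW]
  rw [Fin.sum_univ_succ]
  simp only [Fin.sum_univ_succ (n := n + 2), Fin.cons_zero, Fin.cons_succ, hW0, hW0']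
  simp only [add_mul, mul_add, Finset.sum_add_distrib, ite_mul, mul_ite, zero_mul, mul_zero,
    Finset.sum_ite_eq', Finset.sum_ite_irrel, Finset.sum_const_zero, Finset.mem_univ, if_true,
    sub_self]
  ring

/-- `𝐧(F_p) − 𝐧(F_{p*}) = sgn(−f₁₂(d₁₂) − f₁₃(d₁₃))`, where `F_{p*}` is the
matrix of the reduced system associated with `p` at `p*`. -/
theorem statement3 {n : ℕ} (G : SimpleGraph (Fin (n+3))) (hG : IsTLG G)
    (h0 : G.neighborSet 0 = {1, 2}) (h12 : G.Adj 1 2)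
    (f : Fin (n+3) → Fin (n+3) → ℝ → ℝ)
    (hsym : ∀ i j, f i j = f j i)
    (hF : ∀ i j, G.Adj i j → MemF (f i j))
    (a : Fin (n+3) → ℝ)
    (hP : ∀ i j, G.Adj i j → a i ≠ a j)
    (heq : IsEquilibrium G f (lineConfig a)) :
    inertia (FMat G f a)
      = inertia (FMat (G.comap Fin.succ)
            (reducedLaws f (virtualG (f 0 1) (f 0 2) (a 0) (a 1) (a 2))) (a ∘ Fin.succ))
        + sgn3 (-(f 0 1 |a 0 - a 1|) - f 0 2 |a 0 - a 2|) := by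
  have hadj : ∀ j, G.Adj 0 j ↔ j = 1 ∨ j = 2 := fun j => by
    rw [← SimpleGraph.mem_neighborSet, h0]; rfl
  have a01 : G.Adj 0 1 := (hadj 1).2 (Or.inl rfl)
  have a02 : G.Adj 0 2 := (hadj 2).2 (Or.inr rfl)
  have hbal : f 0 1 |a 0 - a 1| * (a 1 - a 0) + f 0 2 |a 0 - a 2| * (a 2 - a 0) = 0 := by
    have h := congrArg Prod.fst (heq 0)
    have hne : (1 : Fin (n+3)) ≠ 2 := h12.ne
    rw [← Finset.sum_filter] at h
    have hfil : (Finset.univ.filter fun j => G.Adj 0 j) = {1, 2} := by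
      ext j; simp [hadj]
    rw [hfil, Finset.sum_pair hne] at h
    simpa [lineConfig, dist2, Real.sqrt_sq_eq_abs] using h
  have hg := virtualG_mul (hF 0 1 a01) (hF 0 2 a02) (hP 0 1 a01) (hP 0 2 a02) (hP 1 2 h12) hbal
  have n23 : a 2 - a 1 ≠ 0 := sub_ne_zero.2 (hP 1 2 h12).symm
  set g := virtualG (f 0 1) (f 0 2) (a 0) (a 1) (a 2)
  have key := FMat_dotProduct_cons h0 h12 hsym a g
  generalize f 0 1 |a 0 - a 1| = w₁ at *
  generalize f 0 2 |a 0 - a 2| = w₂ at *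
  generalize g |a 1 - a 2| = γ at *
  have hγ : γ * (w₁ + w₂) = w₁ * w₂ := by
    apply mul_right_cancel₀ n23
    linear_combination (w₁ + w₂) * hg + w₂ * hbal
  refine inertia_of_split_square (FMat_isHermitian _ _ hsym _)
    (FMat_isHermitian _ _ (reducedLaws_symm hsym g) _) (-w₁ - w₂)
    ((w₁ / (w₁ + w₂)) • LinearMap.proj 0 + (w₂ / (w₁ + w₂)) • LinearMap.proj 1) fun t y => ?_
  rw [key]
  simp only [LinearMap.add_apply, LinearMap.smul_apply, LinearMap.proj_apply, smul_eq_mul]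
  by_cases hs : w₁ + w₂ = 0
  · have hw₂ : w₂ = 0 := by
      have : w₂ * (a 2 - a 1) = 0 := by linear_combination hbal - (a 1 - a 0) * hs
      exact (mul_eq_zero.1 this).resolve_right n23
    have hw₁ : w₁ = 0 := by linarith
    have hγ0 : γ = 0 := by
      rw [hw₂, zero_mul] at hg
      exact (mul_eq_zero.1 hg).resolve_right n23
    simp [hw₁, hw₂, hγ0]
  · have : γ = w₁ * w₂ / (w₁ + w₂) := by rw [eq_div_iff hs, hγ]
    rw [this]
    field_simp
    ring
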